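/- arXiv:2103.05388 — 2 statements merged into one kernel-verified Lean document; each statement's English description precedes it below -/
import Mathlib

section
/- For every positive integer m and every β > 0, there exists a constant C > 0 (depending on m and β) such that for all vectors x, y ∈ ℝ³, |P_m(β|x|²)·x − P_m(β|y|²)·y| ≤ C·(P_m(β|x|²) + P_m(β|y|²))·|x − y|, where |·| denotes the Euclidean norm on ℝ³ and P_m(X) = ∑_{k=1}^m X^k/k!. -/
open Real Finset

/-- Truncated exponential polynomial `P_m(X) = ∑_{k=1}^m X^k / k!`. -/
noncomputable def Pm (m : ℕ) (X : ℝ) : ℝ := ∑ k ∈ Finset.Icc 1 m, X ^ k / (Nat.factorial k : ℝ)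

theorem Pm_nonneg (m : ℕ) {X : ℝ} (hX : 0 ≤ X) : 0 ≤ Pm m X :=
  Finset.sum_nonneg fun _ _ => by positivity

theorem pow_sub_pow_mul_le {a b : ℝ} (hb : 0 ≤ b) (hab : b ≤ a) (n : ℕ) :
    (a ^ n - b ^ n) * b ≤ n * a ^ n * (a - b) := by
  have ha : 0 ≤ a := hb.trans hab
  induction n with
  | zero => simp
  | succ n ih =>
    have h1 := mul_le_mul_of_nonneg_left ih ha
    have h2 : b ^ (n + 1) * (a - b) ≤ a ^ (n + 1) * (a - b) :=
      mul_le_mul_of_nonneg_right (pow_le_pow_left₀ hb hab _) (sub_nonneg.2 hab)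
    calc (a ^ (n + 1) - b ^ (n + 1)) * b
        = a * ((a ^ n - b ^ n) * b) + b ^ (n + 1) * (a - b) := by ring
      _ ≤ a * (n * a ^ n * (a - b)) + a ^ (n + 1) * (a - b) := add_le_add h1 h2
      _ = ((n + 1 : ℕ) : ℝ) * a ^ (n + 1) * (a - b) := by push_cast; ring

theorem Pm_mono (m : ℕ) {X Y : ℝ} (hY : 0 ≤ Y) (hYX : Y ≤ X) : Pm m Y ≤ Pm m X :=
  Finset.sum_le_sum fun _ _ => by gcongr

theorem Pm_sub_Pm_mul_le (m : ℕ) {β a b : ℝ} (hβ : 0 ≤ β) (hb : 0 ≤ b) (hab : b ≤ a) :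
    (Pm m (β * a ^ 2) - Pm m (β * b ^ 2)) * b ≤ 2 * m * Pm m (β * a ^ 2) * (a - b) := by
  have ha : 0 ≤ a := hb.trans hab
  have hd : 0 ≤ a - b := sub_nonneg.2 hab
  unfold Pm
  rw [← Finset.sum_sub_distrib, Finset.sum_mul, Finset.mul_sum, Finset.sum_mul]
  refine Finset.sum_le_sum fun k hk => ?_
  have hkm : (k : ℝ) ≤ m := by exact_mod_cast (Finset.mem_Icc.1 hk).2
  have h0 : 0 ≤ β ^ k / (Nat.factorial k : ℝ) := by positivity
  calc ((β * a ^ 2) ^ k / (Nat.factorial k : ℝ) - (β * b ^ 2) ^ k / (Nat.factorial k : ℝ)) * b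
      = β ^ k / (Nat.factorial k : ℝ) * ((a ^ (2 * k) - b ^ (2 * k)) * b) := by
        rw [mul_pow, mul_pow, ← pow_mul, ← pow_mul]; ring
    _ ≤ β ^ k / (Nat.factorial k : ℝ) * (((2 * k : ℕ) : ℝ) * a ^ (2 * k) * (a - b)) :=
        mul_le_mul_of_nonneg_left (pow_sub_pow_mul_le hb hab _) h0
    _ ≤ β ^ k / (Nat.factorial k : ℝ) * ((2 * m) * a ^ (2 * k) * (a - b)) := by
        push_cast
        gcongr
    _ = 2 * m * ((β * a ^ 2) ^ k / (Nat.factorial k : ℝ)) * (a - b) := by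
        rw [mul_pow, ← pow_mul]; ring

theorem norm_Pm_smul_sub_le {E : Type*} [NormedAddCommGroup E] [NormedSpace ℝ E]
    (m : ℕ) {β : ℝ} (hβ : 0 ≤ β) {x y : E} (hxy : ‖y‖ ≤ ‖x‖) :
    ‖Pm m (β * ‖x‖ ^ 2) • x - Pm m (β * ‖y‖ ^ 2) • y‖ ≤
      (2 * m + 1) * (Pm m (β * ‖x‖ ^ 2) + Pm m (β * ‖y‖ ^ 2)) * ‖x - y‖ := by
  have hP : 0 ≤ Pm m (β * ‖x‖ ^ 2) := Pm_nonneg m (by positivity)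
  have hQ : 0 ≤ Pm m (β * ‖y‖ ^ 2) := Pm_nonneg m (by positivity)
  have hmono : Pm m (β * ‖y‖ ^ 2) ≤ Pm m (β * ‖x‖ ^ 2) := Pm_mono m (by positivity) (by gcongr)
  have key := Pm_sub_Pm_mul_le m hβ (norm_nonneg y) hxy
  set P := Pm m (β * ‖x‖ ^ 2)
  set Q := Pm m (β * ‖y‖ ^ 2)
  calc ‖P • x - Q • y‖ = ‖P • (x - y) + (P - Q) • y‖ := by
        congr 1; rw [smul_sub, sub_smul]; abel
    _ ≤ ‖P • (x - y)‖ + ‖(P - Q) • y‖ := norm_add_le _ _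
    _ = P * ‖x - y‖ + (P - Q) * ‖y‖ := by
        rw [norm_smul, norm_smul, Real.norm_of_nonneg hP, Real.norm_of_nonneg (sub_nonneg.2 hmono)]
    _ ≤ P * ‖x - y‖ + 2 * m * P * ‖x - y‖ := by
        have h := norm_sub_norm_le x y
        have : 2 * m * P * (‖x‖ - ‖y‖) ≤ 2 * m * P * ‖x - y‖ := by gcongr
        linarith
    _ = (2 * m + 1) * P * ‖x - y‖ := by ring
    _ ≤ (2 * m + 1) * (P + Q) * ‖x - y‖ := by
        gcongr
        linarith

theorem stmt1 (m : ℕ) (hm : 0 < m) (β : ℝ) (hβ : 0 < β) :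
    ∃ C : ℝ, 0 < C ∧ ∀ x y : EuclideanSpace ℝ (Fin 3),
      ‖Pm m (β * ‖x‖ ^ 2) • x - Pm m (β * ‖y‖ ^ 2) • y‖ ≤
        C * (Pm m (β * ‖x‖ ^ 2) + Pm m (β * ‖y‖ ^ 2)) * ‖x - y‖ := by
  refine ⟨2 * m + 1, by positivity, fun x y => ?_⟩
  rcases le_total ‖y‖ ‖x‖ with h | h
  · exact norm_Pm_smul_sub_le m hβ.le h
  · rw [norm_sub_rev, norm_sub_rev x y, add_comm (Pm m (β * ‖x‖ ^ 2))]
    exact norm_Pm_smul_sub_le m hβ.le h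
end

section
/- Let α, β, R, T > 0 and E ≥ 0. Let F : [0,T] × ℝ³ → ℝ³ be measurable and suppose that ∫_{ℝ³} |F(t,x)|² dx ≤ E for almost every t ∈ [0,T], and that 2α·∫₀^T ∫_{ℝ³} (e^{β|F(t,x)|²} − 1)|F(t,x)|² dx dt ≤ E. Then ∫₀^T ∫_{ℝ³} (e^{β|F(t,x)|²} − 1)|F(t,x)| dx dt ≤ (M_{β,R}·T + 1/(2Rα))·E, where M_{β,R} = sup_{0 < r ≤ R} (e^{βr²} − 1)/r. -/
open MeasureTheory Real Set ENNReal

lemma exp_sub_one_le_mul_exp (u : ℝ) : Real.exp u - 1 ≤ u * Real.exp u := by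
  have h := Real.add_one_le_exp (-u)
  have h' : Real.exp (-u) * Real.exp u = 1 := by rw [← Real.exp_add]; simp
  nlinarith [Real.exp_pos u]

lemma bddAbove_exp_mul_sq_sub_one_div {β : ℝ} (hβ : 0 < β) (R : ℝ) :
    BddAbove ((fun r : ℝ => (Real.exp (β * r ^ 2) - 1) / r) '' Set.Ioc 0 R) := by
  refine ⟨β * R * Real.exp (β * R ^ 2), ?_⟩
  rintro _ ⟨r, ⟨hr, hrR⟩, rfl⟩
  have hR : 0 < R := hr.trans_le hrR
  calc (Real.exp (β * r ^ 2) - 1) / r ≤ β * r ^ 2 * Real.exp (β * r ^ 2) / r := by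
        gcongr
        exact exp_sub_one_le_mul_exp _
    _ = β * r * Real.exp (β * r ^ 2) := by field_simp
    _ ≤ β * R * Real.exp (β * R ^ 2) := by gcongr

lemma exp_mul_sq_sub_one_nonneg {β : ℝ} (hβ : 0 < β) (r : ℝ) :
    0 ≤ Real.exp (β * r ^ 2) - 1 :=
  sub_nonneg.2 (Real.one_le_exp (by positivity))

lemma sSup_exp_mul_sq_sub_one_div_nonneg {β : ℝ} (hβ : 0 < β) (R : ℝ) :
    0 ≤ sSup ((fun r : ℝ => (Real.exp (β * r ^ 2) - 1) / r) '' Set.Ioc 0 R) := by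
  apply Real.sSup_nonneg
  rintro _ ⟨r, hr, rfl⟩
  exact div_nonneg (exp_mul_sq_sub_one_nonneg hβ r) hr.1.le

lemma exp_mul_sq_sub_one_mul_le {β R r : ℝ} (hβ : 0 < β) (hR : 0 < R) (hr : 0 ≤ r) :
    (Real.exp (β * r ^ 2) - 1) * r ≤
      sSup ((fun r : ℝ => (Real.exp (β * r ^ 2) - 1) / r) '' Set.Ioc 0 R) * r ^ 2 +
        1 / R * ((Real.exp (β * r ^ 2) - 1) * r ^ 2) := by
  have hM := sSup_exp_mul_sq_sub_one_div_nonneg hβ R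
  have he := exp_mul_sq_sub_one_nonneg hβ r
  rcases hr.eq_or_lt with rfl | hr0
  · simp
  rcases le_or_gt r R with h | h
  · have hle : (Real.exp (β * r ^ 2) - 1) / r ≤ _ :=
      le_csSup (bddAbove_exp_mul_sq_sub_one_div hβ R) ⟨r, ⟨hr0, h⟩, rfl⟩
    calc (Real.exp (β * r ^ 2) - 1) * r = (Real.exp (β * r ^ 2) - 1) / r * r ^ 2 := by
          field_simp
      _ ≤ _ := by gcongr
      _ ≤ _ := le_add_of_nonneg_right (by positivity)
  · have h1 : 1 ≤ r / R := (one_le_div hR).2 h.le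
    calc (Real.exp (β * r ^ 2) - 1) * r ≤ (Real.exp (β * r ^ 2) - 1) * r * (r / R) :=
          le_mul_of_one_le_right (by positivity) h1
      _ = 1 / R * ((Real.exp (β * r ^ 2) - 1) * r ^ 2) := by ring
      _ ≤ _ := le_add_of_nonneg_left (by positivity)

theorem stmt10 (α β R T E : ℝ) (hα : 0 < α) (hβ : 0 < β) (hR : 0 < R) (hT : 0 < T)
    (hE : 0 ≤ E)
    (F : ℝ → EuclideanSpace ℝ (Fin 3) → EuclideanSpace ℝ (Fin 3))
    (hmeas : Measurable (Function.uncurry F))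
    (h1 : ∀ᵐ t ∂(volume.restrict (Set.Icc (0 : ℝ) T)),
      (∫⁻ x, ENNReal.ofReal (‖F t x‖ ^ 2)) ≤ ENNReal.ofReal E)
    (h2 : ENNReal.ofReal (2 * α) *
        (∫⁻ t in Set.Icc (0 : ℝ) T, ∫⁻ x,
          ENNReal.ofReal ((Real.exp (β * ‖F t x‖ ^ 2) - 1) * ‖F t x‖ ^ 2)) ≤
      ENNReal.ofReal E) :
    (∫⁻ t in Set.Icc (0 : ℝ) T, ∫⁻ x,
        ENNReal.ofReal ((Real.exp (β * ‖F t x‖ ^ 2) - 1) * ‖F t x‖)) ≤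
      ENNReal.ofReal
        ((sSup ((fun r : ℝ => (Real.exp (β * r ^ 2) - 1) / r) '' Set.Ioc 0 R) * T +
          1 / (2 * R * α)) * E) := by
  have hpt := fun t x => exp_mul_sq_sub_one_mul_le hβ hR (norm_nonneg (F t x))
  have hM := sSup_exp_mul_sq_sub_one_div_nonneg hβ R
  set M := sSup ((fun r : ℝ => (Real.exp (β * r ^ 2) - 1) / r) '' Set.Ioc 0 R)
  set G : ℝ → ℝ≥0∞ := fun t => ∫⁻ x,
    ENNReal.ofReal ((Real.exp (β * ‖F t x‖ ^ 2) - 1) * ‖F t x‖ ^ 2)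
  have hinner : ∀ t, (∫⁻ x, ENNReal.ofReal ((Real.exp (β * ‖F t x‖ ^ 2) - 1) * ‖F t x‖)) ≤
      ENNReal.ofReal M * (∫⁻ x, ENNReal.ofReal (‖F t x‖ ^ 2)) +
        ENNReal.ofReal (1 / R) * G t := by
    intro t
    have hFt : Measurable (F t) := hmeas.comp measurable_prodMk_left
    rw [← lintegral_const_mul' _ _ ofReal_ne_top, ← lintegral_const_mul' _ _ ofReal_ne_top,
      ← lintegral_add_left (by fun_prop)]
    refine lintegral_mono fun x => ?_
    have he := exp_mul_sq_sub_one_nonneg hβ ‖F t x‖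
    rw [← ENNReal.ofReal_mul hM, ← ENNReal.ofReal_mul (by positivity),
      ← ENNReal.ofReal_add (by positivity) (by positivity)]
    exact ENNReal.ofReal_le_ofReal (hpt t x)
  have hG : (∫⁻ t in Set.Icc (0 : ℝ) T, G t) ≤ ENNReal.ofReal (E / (2 * α)) := by
    rw [ENNReal.ofReal_div_of_pos (by positivity), ENNReal.le_div_iff_mul_le, mul_comm]
    · exact h2
    · exact Or.inl (ENNReal.ofReal_pos.2 (by positivity)).ne'
    · exact Or.inl ofReal_ne_top
  calc (∫⁻ t in Set.Icc (0 : ℝ) T, ∫⁻ x,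
        ENNReal.ofReal ((Real.exp (β * ‖F t x‖ ^ 2) - 1) * ‖F t x‖))
      ≤ ∫⁻ t in Set.Icc (0 : ℝ) T,
          (ENNReal.ofReal M * ENNReal.ofReal E + ENNReal.ofReal (1 / R) * G t) := by
        refine lintegral_mono_ae ?_
        filter_upwards [h1] with t ht
        exact (hinner t).trans (by gcongr)
    _ = ENNReal.ofReal M * ENNReal.ofReal E * ENNReal.ofReal T +
          ENNReal.ofReal (1 / R) * ∫⁻ t in Set.Icc (0 : ℝ) T, G t := by
        rw [lintegral_add_left measurable_const, lintegral_const_mul' _ G ofReal_ne_top]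
        simp [mul_assoc]
    _ ≤ ENNReal.ofReal M * ENNReal.ofReal E * ENNReal.ofReal T +
          ENNReal.ofReal (1 / R) * ENNReal.ofReal (E / (2 * α)) := by gcongr
    _ = ENNReal.ofReal ((M * T + 1 / (2 * R * α)) * E) := by
        rw [← ENNReal.ofReal_mul hM, ← ENNReal.ofReal_mul (by positivity),
          ← ENNReal.ofReal_mul (by positivity),
          ← ENNReal.ofReal_add (by positivity) (by positivity)]
        congr 1
        field_simp
end
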